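/- Let k = k_n be positive integers with k → ∞ and k/n → 0, let p = p_n ∈ (0,1) with p → 0, and assume U(t)/t^{1/α} → c for some c ∈ (0,∞). Then for every Borel set B ⊂ ℝ^d with positive distance from the origin, lim_{n→∞} (ν(S)/p) · P( X ∈ U(n/k) (kν(S)/(np))^{1/α} · B ) = ν(B). -/

import Mathlib

open MeasureTheory Filter Topology Pointwise

theorem tail_antitone {E : Type*} [NormedAddCommGroup E] [MeasurableSpace E]
    {P : Measure E} [IsProbabilityMeasure P] {V : ℝ → ℝ}
    (hV : ∀ t : ℝ, V t = (P {z | t < ‖z‖}).toReal) : Antitone V := by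
  intro s t hst
  rw [hV, hV]
  exact ENNReal.toReal_mono (measure_ne_top _ _)
    (measure_mono fun z hz => lt_of_le_of_lt hst hz)

theorem pos_of_antitone_of_tendsto_ratio {V : ℝ → ℝ} (hV : Antitone V) (hV0 : ∀ t, 0 ≤ V t)
    {x l : ℝ} (hl : l ≠ 0) (h : Tendsto (fun t => V (t * x) / V t) atTop (𝓝 l)) (t : ℝ) :
    0 < V t := by
  refine (hV0 t).lt_of_ne' fun ht => hl ?_
  refine tendsto_nhds_unique h (tendsto_const_nhds.congr' ?_)
  filter_upwards [eventually_ge_atTop t] with s hs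
  rw [le_antisymm ((hV hs).trans ht.le) (hV0 s), div_zero]

theorem tendsto_ratio_of_tendsto_one {ι : Type*} {l : Filter ι} {V : ℝ → ℝ} {α : ℝ}
    (hV : Antitone V) (hVpos : ∀ t, 0 < V t)
    (hV_rv : ∀ x > (0 : ℝ), Tendsto (fun t => V (t * x) / V t) atTop (𝓝 (x ^ (-α))))
    {s x : ι → ℝ} (hs : Tendsto s l atTop) (hx : Tendsto x l (𝓝 1)) :
    Tendsto (fun i => V (s i * x i) / V (s i)) l (𝓝 1) := by
  have hcont : Tendsto (fun y : ℝ => y ^ (-α)) (𝓝 1) (𝓝 1) := by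
    simpa using (Real.continuousAt_rpow_const 1 (-α) (Or.inl one_ne_zero)).tendsto
  rw [tendsto_order] at hcont ⊢
  constructor
  · intro a ha
    obtain ⟨y, hya, hy1⟩ := (((hcont.1 a ha).filter_mono nhdsWithin_le_nhds).and
      (self_mem_nhdsWithin : Set.Ioi (1 : ℝ) ∈ 𝓝[>] 1)).exists
    have hy1 : 1 < y := hy1
    filter_upwards [hs.eventually (((tendsto_order.1 (hV_rv y (by linarith))).1 a hya)),
      hx.eventually (gt_mem_nhds hy1), hs.eventually (eventually_gt_atTop 0)] with i h1 h2 h3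
    refine h1.trans_le ?_
    have := hVpos (s i)
    gcongr
    exact hV (by gcongr)
  · intro a ha
    obtain ⟨y, ⟨hya, hy0⟩, hy1⟩ := ((((hcont.2 a ha).and (lt_mem_nhds one_pos)).filter_mono
      nhdsWithin_le_nhds).and (self_mem_nhdsWithin : Set.Iio (1 : ℝ) ∈ 𝓝[<] 1)).exists
    have hy1 : y < 1 := hy1
    filter_upwards [hs.eventually (((tendsto_order.1 (hV_rv y hy0)).2 a hya)),
      hx.eventually (lt_mem_nhds hy1), hs.eventually (eventually_gt_atTop 0)] with i h1 h2 h3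
    refine lt_of_le_of_lt ?_ h1
    have := hVpos (s i)
    gcongr
    exact hV (by gcongr)

theorem tail_quantile {E : Type*} [NormedAddCommGroup E] [MeasurableSpace E] [BorelSpace E]
    {P : Measure E} [IsProbabilityMeasure P] {V U : ℝ → ℝ}
    (hV : ∀ t : ℝ, V t = (P {z | t < ‖z‖}).toReal)
    (hU : ∀ t > (1 : ℝ), P {z | ‖z‖ ≤ U t} = ENNReal.ofReal (1 - 1 / t)) {t : ℝ} (ht : 1 < t) :
    V (U t) = 1 / t := by
  have hm : MeasurableSet {z : E | ‖z‖ ≤ U t} := measurableSet_le measurable_norm measurable_const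
  have hc : {z : E | U t < ‖z‖} = {z | ‖z‖ ≤ U t}ᶜ := by ext; simp
  have h1 : 1 / t ≤ 1 := by rw [div_le_one (by linarith)]; exact ht.le
  rw [hV, hc, ← Measure.real, probReal_compl_eq_one_sub hm, Measure.real, hU t ht,
    ENNReal.toReal_ofReal (by linarith)]
  ring

section Density

variable {d : ℕ} {P : Measure (EuclideanSpace ℝ (Fin d))}
  {f q : EuclideanSpace ℝ (Fin d) → ℝ} {V : ℝ → ℝ} {α : ℝ}

theorem setIntegral_scaled_density (hf_cont : Continuous f) (hf_pos : ∀ z, 0 < f z)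
    (hP : P = volume.withDensity (fun z => ENNReal.ofReal (f z)))
    {t : ℝ} (ht : 0 < t) {B : Set (EuclideanSpace ℝ (Fin d))} (hB : MeasurableSet B) :
    ∫ z in B, f (t • z) / (t ^ (-(d : ℝ)) * V t) = (P (t • B)).toReal / V t := by
  have hPB : (P (t • B)).toReal = ∫ z in t • B, f z := by
    rw [integral_eq_lintegral_of_nonneg_ae (ae_of_all _ fun z => (hf_pos z).le)
      hf_cont.aestronglyMeasurable, hP, withDensity_apply _ (hB.const_smul₀ t)]
  rw [integral_div, Measure.setIntegral_comp_smul_of_pos volume f B ht, hPB,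
    finrank_euclideanSpace_fin, Real.rpow_neg ht.le, Real.rpow_natCast, smul_eq_mul]
  exact mul_div_mul_left _ _ (by positivity)

theorem setIntegral_scaled_density_tail (hf_cont : Continuous f) (hf_pos : ∀ z, 0 < f z)
    (hP : P = volume.withDensity (fun z => ENNReal.ofReal (f z)))
    (hV : ∀ t : ℝ, V t = (P {z | t < ‖z‖}).toReal) {t : ℝ} (ht : 0 < t) (R : ℝ) :
    ∫ z in {z : EuclideanSpace ℝ (Fin d) | R < ‖z‖}, f (t • z) / (t ^ (-(d : ℝ)) * V t)
      = V (t * R) / V t := by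
  rw [setIntegral_scaled_density hf_cont hf_pos hP ht
    (measurableSet_lt measurable_const measurable_norm), hV (t * R)]
  congr 3
  ext z
  rw [Set.mem_smul_set_iff_inv_smul_mem₀ ht.ne']
  simp only [Set.mem_ofPred_eq, norm_smul, norm_inv, Real.norm_of_nonneg ht.le]
  rw [lt_inv_mul_iff₀ ht]

variable [IsProbabilityMeasure P]

theorem integrable_of_withDensity (hf_cont : Continuous f) (hf_pos : ∀ z, 0 < f z)
    (hP : P = volume.withDensity (fun z => ENNReal.ofReal (f z))) : Integrable f := by
  rw [← lintegral_ofReal_ne_top_iff_integrable hf_cont.aestronglyMeasurable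
    (ae_of_all _ fun z => (hf_pos z).le), ← setLIntegral_univ,
    ← withDensity_apply _ MeasurableSet.univ, ← hP]
  exact measure_ne_top _ _

theorem integrable_scaled_density (hf_cont : Continuous f) (hf_pos : ∀ z, 0 < f z)
    (hP : P = volume.withDensity (fun z => ENNReal.ofReal (f z))) {t : ℝ} (ht : 0 < t) (a : ℝ) :
    Integrable fun z => f (t • z) / a :=
  ((integrable_of_withDensity hf_cont hf_pos hP).comp_smul ht.ne').div_const a

theorem eventually_scaled_density_le (hf_cont : Continuous f) (hf_pos : ∀ z, 0 < f z)
    (hV : Antitone V) (hVpos : ∀ t, 0 < V t)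
    (hV_rv : ∀ x > (0 : ℝ), Tendsto (fun t => V (t * x) / V t) atTop (𝓝 (x ^ (-α))))
    (hq_unif : ∀ δ > (0 : ℝ), ∃ t₀ > (0 : ℝ), ∀ t ≥ t₀,
      ∀ z : EuclideanSpace ℝ (Fin d), ‖z‖ = 1 →
        |f (t • z) / (t ^ (-(d : ℝ)) * V t) - q z| ≤ δ) {r : ℝ} (hr : 0 < r) :
    ∃ C, ∀ᶠ t in atTop, ∀ z : EuclideanSpace ℝ (Fin d), r ≤ ‖z‖ →
      f (t • z) / (t ^ (-(d : ℝ)) * V t) ≤ C := by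
  obtain ⟨t₀, ht₀, h⟩ := hq_unif 1 one_pos
  obtain ⟨M, hM⟩ := (isCompact_sphere (0 : EuclideanSpace ℝ (Fin d)) 1).exists_bound_of_continuousOn
    (f := fun z => f (t₀ • z) / (t₀ ^ (-(d : ℝ)) * V t₀)) (by fun_prop)
  have hsphere : ∀ t ≥ t₀, ∀ w : EuclideanSpace ℝ (Fin d), ‖w‖ = 1 →
      f (t • w) / (t ^ (-(d : ℝ)) * V t) ≤ M + 2 := by
    intro t ht w hw
    have h1 := abs_le.1 (h t ht w hw)
    have h2 := abs_le.1 (h t₀ le_rfl w hw)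
    have h3 := (le_abs_self _).trans (hM w (by simpa using hw))
    linarith [h1.2, h2.1]
  refine ⟨(M + 2) * (r ^ (-(d : ℝ)) * (r ^ (-α) + 1)), ?_⟩
  filter_upwards [eventually_ge_atTop (t₀ / r), eventually_gt_atTop 0,
    (tendsto_order.1 (hV_rv r hr)).2 _ (lt_add_one _)] with t ht ht0 htV z hz
  have hρ : 0 < ‖z‖ := hr.trans_le hz
  have hw : ‖(‖z‖⁻¹ • z)‖ = 1 := by
    rw [norm_smul, norm_inv, norm_norm, inv_mul_cancel₀ hρ.ne']
  have htρ : t₀ ≤ t * ‖z‖ := ((div_le_iff₀ hr).1 ht).trans (by gcongr)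
  have hb := hsphere (t * ‖z‖) htρ _ hw
  rw [smul_smul, mul_assoc, mul_inv_cancel₀ hρ.ne', mul_one,
    Real.mul_rpow ht0.le hρ.le] at hb
  have hVt := hVpos t
  have hVtz := hVpos (t * ‖z‖)
  have htd : 0 < t ^ (-(d : ℝ)) := Real.rpow_pos_of_pos ht0 _
  have hzd : 0 < ‖z‖ ^ (-(d : ℝ)) := Real.rpow_pos_of_pos hρ _
  have hM2 : 0 ≤ M + 2 := le_trans (div_nonneg (hf_pos _).le (by positivity)) hb
  calc f (t • z) / (t ^ (-(d : ℝ)) * V t)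
      = f (t • z) / (t ^ (-(d : ℝ)) * ‖z‖ ^ (-(d : ℝ)) * V (t * ‖z‖)) *
          (‖z‖ ^ (-(d : ℝ)) * (V (t * ‖z‖) / V t)) := by field_simp
    _ ≤ (M + 2) * (r ^ (-(d : ℝ)) * (r ^ (-α) + 1)) := by
        refine mul_le_mul hb (mul_le_mul ?_ ?_ (by positivity) (by positivity))
          (by positivity) hM2
        · exact Real.rpow_le_rpow_of_nonpos hr hz (by simp)
        · refine le_trans ?_ htV.le
          gcongr
          exact hV (by gcongr)

theorem aestronglyMeasurable_limit_density (hf_cont : Continuous f)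
    (hq_lim : ∀ z : EuclideanSpace ℝ (Fin d), z ≠ 0 →
      Tendsto (fun t : ℝ => f (t • z) / (t ^ (-(d : ℝ)) * V t)) atTop (𝓝 (q z)))
    {B : Set (EuclideanSpace ℝ (Fin d))} (hB : MeasurableSet B) (h0 : ∀ z ∈ B, z ≠ 0) :
    AEStronglyMeasurable q (volume.restrict B) := by
  refine (aemeasurable_of_tendsto_metrizable_ae (atTop : Filter ℝ) (fun t => ?_)
    ((ae_restrict_mem hB).mono fun z hz => hq_lim z (h0 z hz))).aestronglyMeasurable
  exact Continuous.aemeasurable (by fun_prop)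

theorem limit_density_tail (hf_cont : Continuous f) (hf_pos : ∀ z, 0 < f z)
    (hP : P = volume.withDensity (fun z => ENNReal.ofReal (f z)))
    (hV : ∀ t : ℝ, V t = (P {z | t < ‖z‖}).toReal)
    (hV_rv : ∀ x > (0 : ℝ), Tendsto (fun t => V (t * x) / V t) atTop (𝓝 (x ^ (-α))))
    (hq_nonneg : ∀ z : EuclideanSpace ℝ (Fin d), z ≠ 0 → 0 ≤ q z)
    (hq_lim : ∀ z : EuclideanSpace ℝ (Fin d), z ≠ 0 →
      Tendsto (fun t : ℝ => f (t • z) / (t ^ (-(d : ℝ)) * V t)) atTop (𝓝 (q z)))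
    {R : ℝ} (hR : 0 < R) :
    IntegrableOn q {z | R < ‖z‖} ∧ ∫ z in {z | R < ‖z‖}, q z ≤ R ^ (-α) := by
  set A : Set (EuclideanSpace ℝ (Fin d)) := {z | R < ‖z‖} with hA
  have hAm : MeasurableSet A := measurableSet_lt measurable_const measurable_norm
  have hA0 : ∀ z ∈ A, z ≠ 0 := fun z hz => norm_pos_iff.1 (hR.trans hz)
  have hqm := aestronglyMeasurable_limit_density hf_cont hq_lim hAm hA0
  have hq0 : 0 ≤ᵐ[volume.restrict A] q :=
    (ae_restrict_mem hAm).mono fun z hz => hq_nonneg z (hA0 z hz)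
  have hfatou : ∫⁻ z in A, ENNReal.ofReal (q z) ≤ ENNReal.ofReal (R ^ (-α)) := by
    calc ∫⁻ z in A, ENNReal.ofReal (q z)
        = ∫⁻ z in A, liminf (fun t : ℝ =>
            ENNReal.ofReal (f (t • z) / (t ^ (-(d : ℝ)) * V t))) atTop := by
          refine setLIntegral_congr_fun hAm fun z hz => ?_
          exact (ENNReal.tendsto_ofReal (hq_lim z (hA0 z hz))).liminf_eq.symm
      _ ≤ liminf (fun t : ℝ => ∫⁻ z in A,
            ENNReal.ofReal (f (t • z) / (t ^ (-(d : ℝ)) * V t))) atTop :=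
          lintegral_liminf_le' fun t =>
            (Continuous.aemeasurable (by fun_prop) : AEMeasurable _ _).ennreal_ofReal
      _ = ENNReal.ofReal (R ^ (-α)) := by
          refine Tendsto.liminf_eq ((ENNReal.tendsto_ofReal (hV_rv R hR)).congr' ?_)
          filter_upwards [eventually_gt_atTop 0] with t ht
          rw [← setIntegral_scaled_density_tail hf_cont hf_pos hP hV ht R,
            ofReal_integral_eq_lintegral_ofReal
              (integrable_scaled_density hf_cont hf_pos hP ht _).integrableOn]
          refine ae_of_all _ fun z => div_nonneg (hf_pos _).le ?_
          rw [hV]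
          positivity
  refine ⟨(lintegral_ofReal_ne_top_iff_integrable hqm hq0).1
    (hfatou.trans_lt ENNReal.ofReal_lt_top).ne, ?_⟩
  rw [integral_eq_lintegral_of_nonneg_ae hq0 hqm]
  exact ENNReal.toReal_le_of_le_ofReal (by positivity) hfatou

theorem tendsto_measure_smul_div_tail (hf_cont : Continuous f) (hf_pos : ∀ z, 0 < f z)
    (hP : P = volume.withDensity (fun z => ENNReal.ofReal (f z))) (hα : 0 < α)
    (hV : ∀ t : ℝ, V t = (P {z | t < ‖z‖}).toReal) (hVpos : ∀ t, 0 < V t)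
    (hV_rv : ∀ x > (0 : ℝ), Tendsto (fun t => V (t * x) / V t) atTop (𝓝 (x ^ (-α))))
    (hq_nonneg : ∀ z : EuclideanSpace ℝ (Fin d), z ≠ 0 → 0 ≤ q z)
    (hq_lim : ∀ z : EuclideanSpace ℝ (Fin d), z ≠ 0 →
      Tendsto (fun t : ℝ => f (t • z) / (t ^ (-(d : ℝ)) * V t)) atTop (𝓝 (q z)))
    (hq_unif : ∀ δ > (0 : ℝ), ∃ t₀ > (0 : ℝ), ∀ t ≥ t₀,
      ∀ z : EuclideanSpace ℝ (Fin d), ‖z‖ = 1 →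
        |f (t • z) / (t ^ (-(d : ℝ)) * V t) - q z| ≤ δ)
    {B : Set (EuclideanSpace ℝ (Fin d))} (hB : MeasurableSet B)
    (hB_away : ∃ r > (0 : ℝ), ∀ z ∈ B, r ≤ ‖z‖) :
    Tendsto (fun t => (P (t • B)).toReal / V t) atTop (𝓝 (∫ z in B, q z)) := by
  obtain ⟨r, hr, hBr⟩ := hB_away
  obtain ⟨C, hC⟩ := eventually_scaled_density_le hf_cont hf_pos (tail_antitone hV) hVpos hV_rv
    hq_unif hr
  have hB0 : ∀ z ∈ B, z ≠ 0 := fun z hz => norm_pos_iff.1 (hr.trans_le (hBr z hz))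
  have hnn : ∀ t > (0 : ℝ), ∀ z, 0 ≤ f (t • z) / (t ^ (-(d : ℝ)) * V t) := fun t ht z =>
    div_nonneg (hf_pos _).le (mul_nonneg (Real.rpow_nonneg ht.le _) (hVpos t).le)
  have htrunc : ∀ R : ℝ, Tendsto
      (fun t => ∫ z in B ∩ {z | R < ‖z‖}ᶜ, f (t • z) / (t ^ (-(d : ℝ)) * V t)) atTop
      (𝓝 (∫ z in B ∩ {z | R < ‖z‖}ᶜ, q z)) := by
    intro R
    have hBR : MeasurableSet (B ∩ {z | R < ‖z‖}ᶜ) :=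
      hB.inter (measurableSet_lt measurable_const measurable_norm).compl
    refine tendsto_integral_filter_of_dominated_convergence (fun _ => C)
      (Eventually.of_forall fun t => Continuous.aestronglyMeasurable (by fun_prop)) ?_ ?_
      ((ae_restrict_mem hBR).mono fun z hz => hq_lim z (hB0 z hz.1))
    · filter_upwards [hC, eventually_gt_atTop 0] with t ht ht0
      filter_upwards [ae_restrict_mem hBR] with z hz
      rw [Real.norm_of_nonneg (hnn t ht0 z)]
      exact ht z (hBr z hz.1)
    · refine integrableOn_const ?_
      refine ((measure_mono fun z hz => ?_).trans_lt
        (measure_closedBall_lt_top (x := (0 : EuclideanSpace ℝ (Fin d))) (r := R))).ne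
      simpa using hz.2
  have hqB : IntegrableOn q B :=
    (limit_density_tail hf_cont hf_pos hP hV hV_rv hq_nonneg hq_lim (half_pos hr)).1.mono_set
      fun z hz => (half_lt_self hr).trans_le (hBr z hz)
  rw [Metric.tendsto_nhds]
  intro ε hε
  obtain ⟨R, hRε, hR⟩ := (((tendsto_order.1 (tendsto_rpow_neg_atTop hα)).2 (ε / 4)
    (by positivity)).and (eventually_gt_atTop 0)).exists
  have hAm : MeasurableSet {z : EuclideanSpace ℝ (Fin d) | R < ‖z‖} :=
    measurableSet_lt measurable_const measurable_norm
  obtain ⟨hqA, hqA_le⟩ := limit_density_tail hf_cont hf_pos hP hV hV_rv hq_nonneg hq_lim hR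
  have hqA0 : 0 ≤ᵐ[volume.restrict {z | R < ‖z‖}] q :=
    (ae_restrict_mem hAm).mono fun z hz => hq_nonneg z (norm_pos_iff.1 (hR.trans hz))
  have hI := integral_inter_add_sdiff hAm hqB
  have hI_le := (setIntegral_mono_set hqA hqA0 (Set.inter_subset_right (s := B)).eventuallyLE)
  have hI_nn : 0 ≤ ∫ z in B ∩ {z | R < ‖z‖}, q z :=
    setIntegral_nonneg (hB.inter hAm) fun z hz => hq_nonneg z (hB0 z hz.1)
  filter_upwards [Metric.tendsto_nhds.1 (htrunc R) (ε / 4) (by positivity), eventually_gt_atTop 0,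
    (tendsto_order.1 (hV_rv R hR)).2 (ε / 4) hRε] with t h1 ht hVt
  have hint := integrable_scaled_density hf_cont hf_pos hP ht (t ^ (-(d : ℝ)) * V t)
  have hG := integral_inter_add_sdiff hAm (hint.integrableOn (s := B))
  have hG_le := (setIntegral_mono_set hint.integrableOn (ae_of_all _ (hnn t ht))
    (Set.inter_subset_right (s := B) (t := {z | R < ‖z‖})).eventuallyLE)
  rw [setIntegral_scaled_density_tail hf_cont hf_pos hP hV ht R] at hG_le
  have hG_nn : 0 ≤ ∫ z in B ∩ {z | R < ‖z‖}, f (t • z) / (t ^ (-(d : ℝ)) * V t) :=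
    integral_nonneg (hnn t ht)
  rw [← setIntegral_scaled_density hf_cont hf_pos hP ht hB, ← hG, ← hI, Real.dist_eq, abs_lt]
  rw [Real.dist_eq, abs_lt, ← Set.sdiff_eq] at h1
  constructor <;> linarith [h1.1, h1.2]

end Density

/-- Under conditions (a), (b), (c), for every Borel set `B` with
positive distance from the origin,
`lim_{n→∞} (ν(S)/p) P(X ∈ U(n/k)(kν(S)/(np))^{1/α} B) = ν(B)`. -/
theorem extreme_risk_inflated_scaling_convergence
    (d : ℕ) (hd : 2 ≤ d)
    (P : Measure (EuclideanSpace ℝ (Fin d))) [IsProbabilityMeasure P]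
    (f : EuclideanSpace ℝ (Fin d) → ℝ)
    (hf_cont : Continuous f) (hf_pos : ∀ z, 0 < f z)
    (hP : P = volume.withDensity (fun z => ENNReal.ofReal (f z)))
    (α : ℝ) (hα : 0 < α)
    -- V = 1 − H, regularly varying with index −α
    (V : ℝ → ℝ)
    (hV_def : ∀ t : ℝ, V t = (P {z | t < ‖z‖}).toReal)
    (hV_rv : ∀ x > (0 : ℝ),
      Tendsto (fun t => V (t * x) / V t) atTop (𝓝 (x ^ (-α))))
    (q : EuclideanSpace ℝ (Fin d) → ℝ)
    (hq_nonneg : ∀ z : EuclideanSpace ℝ (Fin d), z ≠ 0 → 0 ≤ q z)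
    (hq_lim : ∀ z : EuclideanSpace ℝ (Fin d), z ≠ 0 →
      Tendsto (fun t : ℝ => f (t • z) / (t ^ (-(d : ℝ)) * V t)) atTop (𝓝 (q z)))
    (hq_unif : ∀ δ > (0 : ℝ), ∃ t₀ > (0 : ℝ), ∀ t ≥ t₀,
      ∀ z : EuclideanSpace ℝ (Fin d), ‖z‖ = 1 →
        |f (t • z) / (t ^ (-(d : ℝ)) * V t) - q z| ≤ δ)
    -- the quantile function U(t) = H⁻¹(1 − 1/t), satisfying condition (c)
    (U : ℝ → ℝ)
    (hU : ∀ t > (1 : ℝ), P {z | ‖z‖ ≤ U t} = ENNReal.ofReal (1 - 1 / t))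
    (c : ℝ) (hc : 0 < c)
    (hUc : Tendsto (fun t : ℝ => U t / t ^ (1 / α)) atTop (𝓝 c))
    -- ν(S) ∈ (0,∞), with S = {z ≠ 0 : q(z) ≤ 1}
    (hS_int : IntegrableOn q {z : EuclideanSpace ℝ (Fin d) | z ≠ 0 ∧ q z ≤ 1} volume)
    (hS_pos : 0 < ∫ z in {z : EuclideanSpace ℝ (Fin d) | z ≠ 0 ∧ q z ≤ 1}, q z)
    -- condition (b) and p → 0
    (k : ℕ → ℕ) (hk_pos : ∀ n, 0 < k n)
    (hk_top : Tendsto (fun n => (k n : ℝ)) atTop atTop)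
    (hkn : Tendsto (fun n => (k n : ℝ) / n) atTop (𝓝 0))
    (p : ℕ → ℝ) (hp_mem : ∀ n, p n ∈ Set.Ioo (0 : ℝ) 1)
    (hp0 : Tendsto p atTop (𝓝 0))
    (B : Set (EuclideanSpace ℝ (Fin d))) (hB_meas : MeasurableSet B)
    (hB_away : ∃ r > (0 : ℝ), ∀ z ∈ B, r ≤ ‖z‖) :
    Tendsto (fun n : ℕ =>
        ((∫ z in {z : EuclideanSpace ℝ (Fin d) | z ≠ 0 ∧ q z ≤ 1}, q z) / p n) *
        (P ((U ((n : ℝ) / k n) *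
            ((k n * ∫ z in {z : EuclideanSpace ℝ (Fin d) | z ≠ 0 ∧ q z ≤ 1}, q z) /
              (n * p n)) ^ (1 / α)) • B)).toReal)
      atTop (𝓝 (∫ z in B, q z)) := by
  set m := ∫ z in {z : EuclideanSpace ℝ (Fin d) | z ≠ 0 ∧ q z ≤ 1}, q z
  have hVanti := tail_antitone hV_def
  have hVpos := pos_of_antitone_of_tendsto_ratio hVanti
    (fun t => by rw [hV_def]; exact ENNReal.toReal_nonneg)
    (Real.rpow_pos_of_pos one_pos (-α)).ne' (hV_rv 1 one_pos)
  have hτ : Tendsto (fun n => m / p n) atTop atTop :=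
    (tendsto_nhdsWithin_iff.2 ⟨hp0, Eventually.of_forall fun n => (hp_mem n).1⟩
      ).inv_tendsto_nhdsGT_zero.const_mul_atTop hS_pos
  have hnk : Tendsto (fun n : ℕ => (n : ℝ) / k n) atTop atTop := by
    have : Tendsto (fun n : ℕ => (k n : ℝ) / n) atTop (𝓝[>] 0) := by
      refine tendsto_nhdsWithin_iff.2 ⟨hkn, ?_⟩
      filter_upwards [eventually_gt_atTop 0] with n hn
      have := hk_pos n
      exact Set.mem_Ioi.2 (by positivity)
    simpa [Pi.inv_def] using this.inv_tendsto_nhdsGT_zero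
  set s : ℕ → ℝ := fun n => U ((n : ℝ) / k n) * ((k n * m) / (n * p n)) ^ (1 / α) with hs_def
  have hs_ratio : Tendsto (fun n => s n / (m / p n) ^ (1 / α)) atTop (𝓝 c) := by
    refine (hUc.comp hnk).congr' ?_
    filter_upwards [eventually_gt_atTop 0] with n hn
    have hk : (0 : ℝ) < k n := by exact_mod_cast hk_pos n
    have hn' : (0 : ℝ) < n := by exact_mod_cast hn
    have hp := (hp_mem n).1
    have hsplit : (m / p n) ^ (1 / α) =
        ((k n * m) / (n * p n)) ^ (1 / α) * ((n : ℝ) / k n) ^ (1 / α) := by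
      rw [← Real.mul_rpow (by positivity) (by positivity)]
      congr 1
      field_simp
    have : 0 < ((k n * m) / (n * p n)) ^ (1 / α) := by positivity
    simp only [hs_def, Function.comp_apply, hsplit]
    field_simp
  have hτα : Tendsto (fun n => (m / p n) ^ (1 / α)) atTop atTop :=
    (tendsto_rpow_atTop (by positivity)).comp hτ
  have hs : Tendsto s atTop atTop := by
    refine (hτα.atTop_mul_pos hc hs_ratio).congr' ?_
    filter_upwards [hτα.eventually_gt_atTop 0] with n hn
    field_simp
  have hUs : Tendsto (fun n => U (m / p n) / s n) atTop (𝓝 1) := by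
    have := (hUc.comp hτ).div hs_ratio hc.ne'
    rw [div_self hc.ne'] at this
    refine this.congr' ?_
    filter_upwards [hτα.eventually_gt_atTop 0] with n hn
    simp only [Pi.div_apply, Function.comp_apply]
    rw [div_div_div_cancel_right₀ hn.ne']
  have hVs : Tendsto (fun n => m / p n * V (s n)) atTop (𝓝 1) := by
    have := (tendsto_ratio_of_tendsto_one hVanti hVpos hV_rv hs hUs).inv₀ one_ne_zero
    rw [inv_one] at this
    refine this.congr' ?_
    filter_upwards [hs.eventually_gt_atTop 0, hτ.eventually_gt_atTop 1] with n hsn hn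
    rw [mul_div_cancel₀ _ hsn.ne', tail_quantile hV_def hU hn, inv_div]
    field_simp
  have hmain := hVs.mul ((tendsto_measure_smul_div_tail hf_cont hf_pos hP hα hV_def hVpos hV_rv
    hq_nonneg hq_lim hq_unif hB_meas hB_away).comp hs)
  rw [one_mul] at hmain
  refine hmain.congr fun n => ?_
  rw [Function.comp_apply, mul_assoc, mul_div_cancel₀ _ (hVpos (s n)).ne']
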